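/- Let (c^(N))_{N≥2} be a family of conductances satisfying condition (LLN). For each N, let g_N : {1,…,N} → ℝ satisfy Δ^{c^(N)} g_N = −gap_N·g_N and g_N(1) = 1, and let h_N(x) := cos(π·(x − 1/2)/N). Then lim_{N→∞} max_{2 ≤ x ≤ N} |N·c^(N)(x−1)·(g_N(x) − g_N(x−1)) − N·(h_N(x) − h_N(x−1))| = 0. -/

import Mathlib

open Filter Topology

/-- The generator `Δ^c` of the random walk with conductances `c` on `⟦1, N⟧`. -/
def gen (N : ℕ) (c : ℕ → ℝ) (f : ℕ → ℝ) (x : ℕ) : ℝ :=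
  (if x < N then c x * (f (x + 1) - f x) else 0) +
  (if 2 ≤ x then c (x - 1) * (f (x - 1) - f x) else 0)

/-- `lam` is an eigenvalue of `−Δ^c`. -/
def IsEigenvalue (N : ℕ) (c : ℕ → ℝ) (lam : ℝ) : Prop :=
  ∃ f : ℕ → ℝ, (∃ x ∈ Finset.Icc 1 N, f x ≠ 0) ∧
    ∀ x ∈ Finset.Icc 1 N, gen N c f x = -lam * f x

/-- The spectral gap: the smallest strictly positive eigenvalue of `−Δ^c`. -/
noncomputable def spectralGap (N : ℕ) (c : ℕ → ℝ) : ℝ :=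
  sInf {lam : ℝ | 0 < lam ∧ IsEigenvalue N c lam}

/-- `rsum r n m = Σ_{x=n}^{m-1} r(x)`. -/
def rsum (r : ℕ → ℝ) (n m : ℕ) : ℝ := ∑ x ∈ Finset.Ico n m, r x

/-- Condition (LLN): `(1/N)·sup_{1 ≤ n < m ≤ N} |r^{(N)}(n,m) − (m−n)| → 0`. -/
def LLN (r : ℕ → ℕ → ℝ) : Prop :=
  ∀ ε > (0 : ℝ), ∃ N₀ : ℕ, ∀ N ≥ N₀, ∀ n m : ℕ, 1 ≤ n → n < m → m ≤ N →
    |rsum (r N) n m - ((m : ℝ) - (n : ℝ))| ≤ ε * N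


/-- `h_N(x) = cos(π(x − 1/2)/N)`. -/
noncomputable def hfun (N : ℕ) (x : ℕ) : ℝ := Real.cos (Real.pi * ((x : ℝ) - 1/2) / N)


def Sh (N : ℕ) (r : ℕ → ℝ) (lam : ℝ) (g : ℕ → ℝ) : Prop :=
  g 1 = 1 ∧ ∀ x, 1 ≤ x → x < N → g (x + 1) = g x - lam * r x * ∑ z ∈ Finset.Ico 1 (x + 1), g z

lemma gen_flux (N : ℕ) (c f : ℕ → ℝ) (lam : ℝ)
    (h : ∀ x ∈ Finset.Icc 1 N, gen N c f x = -lam * f x) :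
    ∀ x, 1 ≤ x → x < N → c x * (f (x + 1) - f x) = -lam * ∑ z ∈ Finset.Ico 1 (x + 1), f z := by
  intro x hx
  induction x, hx using Nat.le_induction with
  | base =>
    intro h1
    have := h 1 (by simp; omega)
    simp [gen, h1] at this
    simpa using this
  | succ n hn ih =>
    intro h1
    have h2 := h (n+1) (by simp; omega)
    have h3 := ih (by omega)
    rw [Finset.sum_Ico_succ_top (by omega)]
    simp only [gen, h1, if_true, show 2 ≤ n+1 by omega, Nat.add_sub_cancel] at h2
    linarith

lemma gen_flux_end (N : ℕ) (hN : 2 ≤ N) (c f : ℕ → ℝ) (lam : ℝ)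
    (h : ∀ x ∈ Finset.Icc 1 N, gen N c f x = -lam * f x) :
    lam * ∑ z ∈ Finset.Ico 1 (N + 1), f z = 0 := by
  obtain ⟨n, rfl⟩ : ∃ n, N = n + 1 := ⟨N - 1, by omega⟩
  have h3 := gen_flux _ c f lam h n (by omega) (by omega)
  have h2 := h (n+1) (by simp)
  simp only [gen, lt_irrefl, if_false, show 2 ≤ n+1 by omega, if_true, Nat.add_sub_cancel] at h2
  rw [Finset.sum_Ico_succ_top (by omega)]
  linarith

lemma gen_Sh (N : ℕ) (c f : ℕ → ℝ) (lam : ℝ) (hc : ∀ x, 1 ≤ x → x ≤ N - 1 → 0 < c x)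
    (h : ∀ x ∈ Finset.Icc 1 N, gen N c f x = -lam * f x) (h1 : f 1 = 1) :
    Sh N (fun x => 1 / c x) lam f := by
  refine ⟨h1, fun x hx hxN => ?_⟩
  have := gen_flux N c f lam h x hx hxN
  have hp := hc x hx (by omega)
  field_simp
  linarith

lemma gen_zero (N : ℕ) (c f : ℕ → ℝ) (lam : ℝ) (hc : ∀ x, 1 ≤ x → x ≤ N - 1 → 0 < c x)
    (h : ∀ x ∈ Finset.Icc 1 N, gen N c f x = -lam * f x) (h1 : f 1 = 0) :
    ∀ x, 1 ≤ x → x ≤ N → f x = 0 := by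
  intro x
  induction x using Nat.strong_induction_on with
  | _ x ih =>
    intro hx hxN
    rcases Nat.lt_or_ge 1 x with hx1 | hx1
    · obtain ⟨n, rfl⟩ : ∃ n, x = n + 1 := ⟨x - 1, by omega⟩
      have h2 := gen_flux N c f lam h n (by omega) (by omega)
      have hp := hc n (by omega) (by omega)
      rw [Finset.sum_eq_zero, ih n (by omega) (by omega) (by omega)] at h2
      · simp at h2
        rcases h2 with h2 | h2
        · linarith
        · exact h2
      · intro z hz
        simp at hz
        exact ih z (by omega) (by omega) (by omega)
    · have : x = 1 := by omega
      rw [this, h1]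

lemma Sh_gen (N : ℕ) (c f : ℕ → ℝ) (lam : ℝ) (hc : ∀ x, 1 ≤ x → x ≤ N - 1 → 0 < c x)
    (h : Sh N (fun x => 1 / c x) lam f) (hS : ∑ z ∈ Finset.Ico 1 (N + 1), f z = 0) :
    ∀ x ∈ Finset.Icc 1 N, gen N c f x = -lam * f x := by
  have key : ∀ x, 1 ≤ x → x < N →
      c x * (f (x + 1) - f x) = -lam * ∑ z ∈ Finset.Ico 1 (x + 1), f z := by
    intro x hx hxN
    have hp := hc x hx (by omega)
    rw [h.2 x hx hxN]
    field_simp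
    ring
  intro x hx
  simp at hx
  have e1 : (if x < N then c x * (f (x + 1) - f x) else 0)
      = -lam * ∑ z ∈ Finset.Ico 1 (x + 1), f z := by
    split_ifs with hxN
    · exact key x hx.1 hxN
    · have : x = N := by omega
      rw [this, hS]; simp
  have e2 : (if 2 ≤ x then c (x - 1) * (f (x - 1) - f x) else 0)
      = lam * ∑ z ∈ Finset.Ico 1 x, f z := by
    split_ifs with hx2
    · obtain ⟨n, rfl⟩ : ∃ n, x = n + 1 := ⟨x - 1, by omega⟩
      have := key n (by omega) (by omega)
      simp only [Nat.add_sub_cancel]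
      linarith
    · have : x = 1 := by omega
      rw [this]; simp
  rw [gen, e1, e2, Finset.sum_Ico_succ_top hx.1]
  ring

noncomputable def shoot (r : ℕ → ℝ) (lam : ℝ) : ℕ → ℝ × ℝ
  | 0 => (1, 1)
  | n + 1 => ((shoot r lam n).1 - lam * r (n + 1) * (shoot r lam n).2,
      (shoot r lam n).2 + ((shoot r lam n).1 - lam * r (n + 1) * (shoot r lam n).2))

lemma shoot_cont (r : ℕ → ℝ) (n : ℕ) : Continuous (fun lam => (shoot r lam n).1) ∧
    Continuous (fun lam => (shoot r lam n).2) := by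
  induction n with
  | zero => simp only [shoot]; constructor <;> fun_prop
  | succ n ih =>
    obtain ⟨h1, h2⟩ := ih
    simp only [shoot]; constructor <;> fun_prop

lemma shoot_sum (r : ℕ → ℝ) (lam : ℝ) (n : ℕ) :
    ∑ z ∈ Finset.Ico 1 (n + 2), (shoot r lam (z - 1)).1 = (shoot r lam n).2 := by
  induction n with
  | zero => simp [shoot]
  | succ n ih =>
    rw [Finset.sum_Ico_succ_top (by omega), ih]
    simp [shoot]

lemma shoot_Sh (N : ℕ) (r : ℕ → ℝ) (lam : ℝ) : Sh N r lam (fun x => (shoot r lam (x - 1)).1) := by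
  refine ⟨by simp [shoot], fun x hx _ => ?_⟩
  obtain ⟨n, rfl⟩ : ∃ n, x = n + 1 := ⟨x - 1, by omega⟩
  rw [show n + 1 + 1 = n + 2 from rfl, shoot_sum]
  simp [shoot]

lemma Sh_volterra (N : ℕ) (r : ℕ → ℝ) (lam : ℝ) (g : ℕ → ℝ) (h : Sh N r lam g) :
    ∀ x, 1 ≤ x → x ≤ N → g x = 1 - lam * ∑ z ∈ Finset.Ico 1 x, g z * rsum r z x := by
  intro x hx
  induction x, hx using Nat.le_induction with
  | base => intro _; simp [h.1]
  | succ n hn ih =>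
    intro h1
    have h3 : ∑ z ∈ Finset.Ico 1 (n+1), g z * rsum r z (n+1)
        = ∑ z ∈ Finset.Ico 1 n, g z * rsum r z n + r n * ∑ z ∈ Finset.Ico 1 (n+1), g z := by
      have : ∀ z ∈ Finset.Ico 1 (n+1), g z * rsum r z (n+1) = g z * rsum r z n + r n * g z := by
        intro z hz
        simp at hz
        rw [rsum, Finset.sum_Ico_succ_top (by omega), rsum]; ring
      rw [Finset.sum_congr rfl this, Finset.sum_add_distrib, ← Finset.mul_sum,
        Finset.sum_Ico_succ_top hn (fun z => g z * rsum r z n)]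
      simp [rsum]
    rw [h.2 n hn (by omega), ih (by omega), h3]
    ring

lemma gronwall (N : ℕ) (e : ℕ → ℝ) (eta A : ℝ) (hA : 0 ≤ A) (heta : 0 ≤ eta)
    (h : ∀ x, 1 ≤ x → x ≤ N → e x ≤ eta + A * ∑ z ∈ Finset.Ico 1 x, e z) :
    ∀ x, 1 ≤ x → x ≤ N → e x ≤ eta * Real.exp (A * N) := by
  have key : ∀ x, 1 ≤ x → x ≤ N →
      eta + A * ∑ z ∈ Finset.Ico 1 x, e z ≤ eta * (1 + A) ^ x := by
    intro x hx
    induction x, hx using Nat.le_induction with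
    | base => intro _; simp; nlinarith
    | succ n hn ih =>
      intro h1
      have h2 := ih (by omega)
      have h3 := h n hn (by omega)
      rw [Finset.sum_Ico_succ_top hn, pow_succ]
      nlinarith
  intro x hx hxN
  refine (h x hx hxN).trans ((key x hx hxN).trans ?_)
  apply mul_le_mul_of_nonneg_left _ heta
  calc (1 + A) ^ x ≤ (1 + A) ^ N := pow_le_pow_right₀ (by linarith) hxN
    _ ≤ (Real.exp A) ^ N := by
      apply pow_le_pow_left₀ (by linarith)
      linarith [Real.add_one_le_exp A]
    _ = Real.exp (A * N) := by rw [← Real.exp_nat_mul]; ring_nf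

lemma rsum_one (n m : ℕ) (h : n ≤ m) : rsum (fun _ => 1) n m = (m : ℝ) - n := by
  simp [rsum, Nat.cast_sub h]

lemma compare (N : ℕ) (hN : 0 < N) (r : ℕ → ℝ) (lam lam' : ℝ) (g g' : ℕ → ℝ) (a d ε : ℝ)
    (hg : Sh N r lam g) (hg' : Sh N (fun _ => 1) lam' g')
    (hl : 0 ≤ lam) (hla : lam * N ^ 2 ≤ a) (hd : |lam - lam'| * N ^ 2 ≤ d)
    (hε0 : 0 ≤ ε) (hε : ε ≤ 1)
    (hr : ∀ n m : ℕ, 1 ≤ n → n < m → m ≤ N → |rsum r n m - ((m : ℝ) - (n : ℝ))| ≤ ε * N)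
    (hb : ∀ x, 1 ≤ x → x ≤ N → |g' x| ≤ 2) :
    ∀ x, 1 ≤ x → x ≤ N → |g x - g' x| ≤ 2 * (a * ε + d) * Real.exp (2 * a) := by
  have hNr : (0:ℝ) < N := by exact_mod_cast hN
  have ha : 0 ≤ a := le_trans (by positivity) hla
  have hd0 : 0 ≤ d := le_trans (by positivity) hd
  have main : ∀ x, 1 ≤ x → x ≤ N → |g x - g' x| ≤
      2 * (a * ε + d) * Real.exp ((2 * a / N) * N) := by
    apply gronwall N (fun x => |g x - g' x|) _ _ (by positivity) (by positivity)
    intro x hx hxN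
    have e : g x - g' x = ∑ z ∈ Finset.Ico 1 x,
        (-(lam * rsum r z x) * (g z - g' z)
          - g' z * (lam * (rsum r z x - ((x:ℝ) - z)) + (lam - lam') * ((x:ℝ) - z))) := by
      rw [Sh_volterra N r lam g hg x hx hxN, Sh_volterra N _ lam' g' hg' x hx hxN]
      rw [Finset.mul_sum, Finset.mul_sum]
      rw [sub_sub_sub_cancel_left, ← Finset.sum_sub_distrib]
      apply Finset.sum_congr rfl
      intro z hz
      simp at hz
      rw [rsum_one z x (by omega)]
      ring
    show |g x - g' x| ≤ _
    rw [e]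
    have hterm : ∀ z ∈ Finset.Ico 1 x, |(-(lam * rsum r z x) * (g z - g' z)
          - g' z * (lam * (rsum r z x - ((x:ℝ) - z)) + (lam - lam') * ((x:ℝ) - z)))| ≤
          2 * a / N * |g z - g' z| + 2 * (a * ε + d) / N := by
      intro z hz
      simp at hz
      have hz1 := hr z x hz.1 hz.2 hxN
      have hz2 := hb z hz.1 (by omega)
      have hxz : |(x:ℝ) - z| ≤ N := by
        have h1 : (z:ℝ) < x := by exact_mod_cast hz.2
        have h2 : (x:ℝ) ≤ N := by exact_mod_cast hxN
        have h3 : (0:ℝ) ≤ z := by positivity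
        rw [abs_of_pos (by linarith)]; linarith
      have hrs : |rsum r z x| ≤ 2 * N := by
        calc |rsum r z x| = |(rsum r z x - ((x:ℝ) - z)) + ((x:ℝ) - z)| := by ring_nf
          _ ≤ |rsum r z x - ((x:ℝ) - z)| + |(x:ℝ) - z| := abs_add_le _ _
          _ ≤ ε * N + N := by linarith
          _ ≤ 2 * N := by nlinarith
      have hlN : lam * N ≤ a / N := by
        rw [le_div_iff₀ hNr]; linarith [hla]
      have hdN : |lam - lam'| * N ≤ d / N := by
        rw [le_div_iff₀ hNr]; linarith [hd]
      have p1 : |lam * rsum r z x| ≤ 2 * a / N := by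
        rw [abs_mul, abs_of_nonneg hl]
        calc lam * |rsum r z x| ≤ lam * (2 * N) := by gcongr
          _ = 2 * (lam * N) := by ring
          _ ≤ 2 * (a / N) := by linarith
          _ = _ := by ring
      have p2 : |lam * (rsum r z x - ((x:ℝ) - z)) + (lam - lam') * ((x:ℝ) - z)|
          ≤ (a * ε + d) / N := by
        calc _ ≤ |lam * (rsum r z x - ((x:ℝ) - z))| + |(lam - lam') * ((x:ℝ) - z)| := abs_add_le _ _
          _ = lam * |rsum r z x - ((x:ℝ) - z)| + |lam - lam'| * |(x:ℝ) - z| := by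
            rw [abs_mul, abs_mul, abs_of_nonneg hl]
          _ ≤ lam * (ε * N) + |lam - lam'| * N := by gcongr
          _ = ε * (lam * N) + |lam - lam'| * N := by ring
          _ ≤ ε * (a / N) + d / N := by gcongr
          _ = _ := by ring
      calc _ ≤ |-(lam * rsum r z x) * (g z - g' z)| + |g' z * (lam * (rsum r z x - ((x:ℝ) - z)) + (lam - lam') * ((x:ℝ) - z))| := abs_sub _ _
        _ ≤ 2 * a / N * |g z - g' z| + 2 * ((a * ε + d) / N) := by
          rw [abs_mul, abs_mul, abs_neg]; gcongr
        _ = _ := by ring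
    refine (Finset.abs_sum_le_sum_abs _ _).trans ((Finset.sum_le_sum hterm).trans ?_)
    rw [Finset.sum_add_distrib, ← Finset.mul_sum, Finset.sum_const, Nat.card_Ico, nsmul_eq_mul,
      add_comm]
    refine add_le_add ?_ le_rfl
    have : ((x - 1 : ℕ) : ℝ) ≤ N := by exact_mod_cast (by omega : x - 1 ≤ N)
    calc _ ≤ (N:ℝ) * (2 * (a * ε + d) / N) := by gcongr
      _ = _ := by field_simp
  intro x hx hxN
  have := main x hx hxN
  rwa [show 2 * a / N * N = 2 * a by field_simp] at this

noncomputable def gh (t : ℝ) (x : ℕ) : ℝ := Real.cos (t * ((x:ℝ) - 1/2)) / Real.cos (t / 2)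

lemma trig_range (t : ℝ) (h0 : 0 < t) (h1 : t ≤ 1) :
    0 < Real.sin t ∧ 0 < Real.sin (t/2) ∧ 1/2 ≤ Real.cos (t/2) := by
  refine ⟨Real.sin_pos_of_pos_of_lt_pi h0 (by linarith [Real.pi_gt_three]),
    Real.sin_pos_of_pos_of_lt_pi (by linarith) (by linarith [Real.pi_gt_three]), ?_⟩
  have := Real.one_sub_sq_div_two_le_cos (x := t/2)
  nlinarith

lemma gh_sum (t : ℝ) (h0 : 0 < t) (h1 : t ≤ 1) (x : ℕ) :
    ∑ z ∈ Finset.Ico 1 (x + 1), gh t z = Real.sin (t * x) / Real.sin t := by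
  obtain ⟨h2, h3, h4⟩ := trig_range t h0 h1
  induction x with
  | zero => simp
  | succ n ih =>
    rw [Finset.sum_Ico_succ_top (by omega), ih, gh]
    have e1 : Real.sin t = 2 * Real.sin (t/2) * Real.cos (t/2) := by
      rw [← Real.sin_two_mul]; ring_nf
    have e2 : Real.sin (t * ((n+1 : ℕ):ℝ)) - Real.sin (t * n)
        = 2 * Real.sin (t/2) * Real.cos (t * (((n+1:ℕ):ℝ) - 1/2)) := by
      rw [Real.sin_sub_sin]; push_cast; ring_nf
    rw [e1]
    have : Real.cos (t/2) ≠ 0 := by linarith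
    have e3 : Real.sin (t * ((n+1 : ℕ):ℝ)) = Real.sin (t * n)
        + 2 * Real.sin (t/2) * Real.cos (t * (((n+1:ℕ):ℝ) - 1/2)) := by linarith
    rw [e3]
    field_simp

lemma gh_step (t : ℝ) (h0 : 0 < t) (h1 : t ≤ 1) (x : ℕ) :
    gh t (x + 1) - gh t x = - (2 - 2 * Real.cos t) * (Real.sin (t * x) / Real.sin t) := by
  obtain ⟨h2, h3, h4⟩ := trig_range t h0 h1
  have e1 : Real.sin t = 2 * Real.sin (t/2) * Real.cos (t/2) := by
    rw [← Real.sin_two_mul]; ring_nf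
  have e0 : Real.cos t = 1 - 2 * Real.sin (t/2) ^ 2 := by
    have h5 := Real.cos_sq_add_sin_sq (t/2)
    have h6 := Real.cos_two_mul (t/2)
    rw [show 2 * (t/2) = t by ring] at h6
    linarith
  have e2 : Real.cos (t * (((x+1 : ℕ):ℝ) - 1/2)) - Real.cos (t * (x - 1/2))
      = -2 * Real.sin (t * x) * Real.sin (t/2) := by
    rw [Real.cos_sub_cos]; push_cast; ring_nf
  have : Real.cos (t/2) ≠ 0 := by linarith
  rw [gh, gh, ← sub_div, e2, e0, e1]
  field_simp
  ring

lemma gh_Sh (N : ℕ) (t : ℝ) (h0 : 0 < t) (h1 : t ≤ 1) :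
    Sh N (fun _ => 1) (2 - 2 * Real.cos t) (gh t) := by
  obtain ⟨h2, h3, h4⟩ := trig_range t h0 h1
  have : Real.cos (t/2) ≠ 0 := by linarith
  refine ⟨?_, fun x hx _ => ?_⟩
  · rw [gh, div_eq_one_iff_eq this]; congr 1; push_cast; ring
  · rw [gh_sum t h0 h1]
    linarith [gh_step t h0 h1 x]

lemma gh_bound (t : ℝ) (h0 : 0 < t) (h1 : t ≤ 1) (x : ℕ) : |gh t x| ≤ 2 := by
  obtain ⟨h2, h3, h4⟩ := trig_range t h0 h1
  rw [gh, abs_div, abs_of_pos (by linarith : 0 < Real.cos (t/2)), div_le_iff₀ (by linarith)]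
  linarith [Real.abs_cos_le_one (t * ((x:ℝ) - 1/2))]

noncomputable def lamf (N : ℕ) (s : ℝ) : ℝ := 2 - 2 * Real.cos (s / N)

lemma lamf_bound (N : ℕ) (hN : 5 ≤ N) (s : ℝ) (h0 : 0 < s) (h5 : s ≤ 5) :
    0 < lamf N s ∧ lamf N s * N ^ 2 ≤ 25 := by
  have hNr : (5:ℝ) ≤ N := by exact_mod_cast hN
  have := Real.one_sub_sq_div_two_le_cos (x := s / N)
  constructor
  · have : Real.cos (s/N) < Real.cos 0 := by
      apply Real.cos_lt_cos_of_nonneg_of_le_pi le_rfl _ (by positivity)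
      have : s / N ≤ 1 := by rw [div_le_one (by linarith)]; linarith
      linarith [Real.pi_gt_three]
    rw [Real.cos_zero] at this
    unfold lamf; linarith
  · have h : lamf N s ≤ (s / N)^2 := by unfold lamf; linarith
    calc lamf N s * N^2 ≤ (s/N)^2 * N^2 := by gcongr
      _ = s^2 := by field_simp
      _ ≤ 25 := by nlinarith

lemma sum_close (N : ℕ) (g g' : ℕ → ℝ) (b : ℝ) (hb : 0 ≤ b) (x : ℕ) (hx : x ≤ N)
    (h : ∀ x, 1 ≤ x → x ≤ N → |g x - g' x| ≤ b) :
    |∑ z ∈ Finset.Ico 1 (x + 1), g z - ∑ z ∈ Finset.Ico 1 (x + 1), g' z| ≤ N * b := by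
  rw [← Finset.sum_sub_distrib]
  refine (Finset.abs_sum_le_sum_abs _ _).trans ?_
  refine (Finset.sum_le_sum (g := fun _ => b) ?_).trans ?_
  · intro z hz; simp at hz; exact h z hz.1 (by omega)
  · simp
    gcongr

lemma sum_approx (N : ℕ) (hN : 5 ≤ N) (r : ℕ → ℝ) (s ε : ℝ) (hs0 : 0 < s) (hs5 : s ≤ 5)
    (g : ℕ → ℝ) (hg : Sh N r (lamf N s) g) (hε0 : 0 ≤ ε) (hε : ε ≤ 1)
    (hr : ∀ n m : ℕ, 1 ≤ n → n < m → m ≤ N → |rsum r n m - ((m : ℝ) - (n : ℝ))| ≤ ε * N) :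
    |∑ z ∈ Finset.Ico 1 (N + 1), g z - Real.sin s / Real.sin (s / N)|
      ≤ N * (50 * ε * Real.exp 50) := by
  have hNr : (5:ℝ) ≤ N := by exact_mod_cast hN
  have ht0 : 0 < s / N := by positivity
  have ht1 : s / N ≤ 1 := by rw [div_le_one (by linarith)]; linarith
  have hb := lamf_bound N hN s hs0 hs5
  have := compare N (by omega) r (lamf N s) (lamf N s) g (gh (s/N)) 25 0 ε hg
    (gh_Sh N _ ht0 ht1) hb.1.le hb.2 (by simp) hε0 hε hr (fun x _ _ => gh_bound _ ht0 ht1 x)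
  have h2 := sum_close N g (gh (s/N)) _ (by positivity) N le_rfl this
  rw [gh_sum _ ht0 ht1, show s / N * N = s by field_simp] at h2
  convert h2 using 2
  norm_num
  ring

lemma sin_lower (δ : ℝ) (h0 : 0 < δ) (h1 : δ < 1) (s : ℝ) (hs0 : 0 < s) (hs : s ≤ Real.pi - δ) :
    Real.sin δ / 5 * s ≤ Real.sin s := by
  have hpi := Real.pi_gt_three
  have hpi4 := Real.pi_le_four
  have hc := strictConcaveOn_sin_Icc.concaveOn
  have hp : 0 < Real.pi - δ := by linarith
  have hu : s / (Real.pi - δ) ≤ 1 := by rw [div_le_one hp]; exact hs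
  have := hc.2 (show Real.pi - δ ∈ Set.Icc 0 Real.pi from ⟨by linarith, by linarith⟩)
    (show (0:ℝ) ∈ Set.Icc 0 Real.pi from ⟨by linarith, by linarith⟩)
    (show 0 ≤ s / (Real.pi - δ) by positivity) (show 0 ≤ 1 - s / (Real.pi - δ) by linarith) (by ring)
  simp only [smul_eq_mul, mul_zero, add_zero, Real.sin_zero, Real.sin_pi_sub] at this
  rw [div_mul_cancel₀ _ hp.ne'] at this
  refine le_trans ?_ this
  have hsd : 0 < Real.sin δ := Real.sin_pos_of_pos_of_lt_pi h0 (by linarith)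
  rw [div_mul_eq_mul_div, div_mul_eq_mul_div, mul_comm]
  gcongr
  linarith

lemma gap_bounds (N : ℕ) (hN : 5 ≤ N) (c : ℕ → ℝ) (hc : ∀ x, 1 ≤ x → x ≤ N - 1 → 0 < c x)
    (δ ε : ℝ) (h0 : 0 < δ) (h1 : δ < 1) (hε0 : 0 ≤ ε) (hε : ε ≤ 1)
    (hr : ∀ n m : ℕ, 1 ≤ n → n < m → m ≤ N →
      |rsum (fun x => 1 / c x) n m - ((m : ℝ) - (n : ℝ))| ≤ ε * N)
    (hεδ : 50 * ε * Real.exp 50 < Real.sin δ / 5) :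
    lamf N (Real.pi - δ) ≤ spectralGap N c ∧ spectralGap N c ≤ lamf N (Real.pi + δ) := by
  have hpi := Real.pi_gt_three
  have hpi4 := Real.pi_le_four
  have hNr : (5:ℝ) ≤ N := by exact_mod_cast hN
  have hN0 : (0:ℝ) < N := by linarith
  have hsd : 0 < Real.sin δ := Real.sin_pos_of_pos_of_lt_pi h0 (by linarith)
  have pos : ∀ s, 0 < s → s ≤ Real.pi - δ → ∀ g, Sh N (fun x => 1 / c x) (lamf N s) g →
      0 < ∑ z ∈ Finset.Ico 1 (N + 1), g z := by
    intro s hs0 hs g hg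
    have h2 := sum_approx N hN _ s ε hs0 (by linarith) g hg hε0 hε hr
    have ht0 : 0 < s / N := by positivity
    have ht1 : s / N ≤ 1 := by rw [div_le_one (by linarith)]; linarith
    have h3 := (trig_range _ ht0 ht1).1
    have h4 : N * (Real.sin δ / 5) ≤ Real.sin s / Real.sin (s / N) := by
      rw [le_div_iff₀ h3]
      calc N * (Real.sin δ / 5) * Real.sin (s/N) ≤ N * (Real.sin δ / 5) * (s/N) := by
            gcongr; exact Real.sin_le ht0.le
        _ = Real.sin δ / 5 * s := by field_simp
        _ ≤ _ := sin_lower δ h0 h1 s hs0 hs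
    have h5 := (abs_le.1 h2).1
    have h6 := mul_lt_mul_of_pos_left hεδ hN0
    linarith
  have neg : ∀ g, Sh N (fun x => 1 / c x) (lamf N (Real.pi + δ)) g →
      ∑ z ∈ Finset.Ico 1 (N + 1), g z < 0 := by
    intro g hg
    have h2 := sum_approx N hN _ (Real.pi + δ) ε (by linarith) (by linarith) g hg hε0 hε hr
    have ht0 : 0 < (Real.pi + δ) / N := by positivity
    have ht1 : (Real.pi + δ) / N ≤ 1 := by rw [div_le_one (by linarith)]; linarith
    have h3 := (trig_range _ ht0 ht1).1
    have h4 : Real.sin (Real.pi + δ) / Real.sin ((Real.pi + δ) / N) ≤ - (N * (Real.sin δ / 5)) := by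
      rw [div_le_iff₀ h3, add_comm, Real.sin_add_pi]
      have : N * (Real.sin δ / 5) * Real.sin ((δ + Real.pi)/N) ≤ Real.sin δ := by
        calc _ ≤ N * (Real.sin δ / 5) * ((δ + Real.pi)/N) := by
              gcongr; exact Real.sin_le (by positivity)
          _ = Real.sin δ * ((δ + Real.pi) / 5) := by field_simp
          _ ≤ Real.sin δ * 1 := by gcongr; linarith
          _ = _ := by ring
      linarith
    have h5 := (abs_le.1 h2).2
    have h6 := mul_lt_mul_of_pos_left hεδ hN0
    linarith
  have hlow : ∀ lam ∈ {lam : ℝ | 0 < lam ∧ IsEigenvalue N c lam}, lamf N (Real.pi - δ) ≤ lam := by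
    rintro lam ⟨hl0, f, ⟨x, hx, hfx⟩, hf⟩
    by_contra! hlt
    have hcont : ContinuousOn (lamf N) (Set.Icc 0 (Real.pi - δ)) := by
      unfold lamf; fun_prop
    obtain ⟨s, hs, hsl⟩ := intermediate_value_Icc (by linarith : (0:ℝ) ≤ Real.pi - δ) hcont
      (show lam ∈ Set.Icc (lamf N 0) (lamf N (Real.pi - δ)) from
        ⟨by simp [lamf]; exact hl0.le, hlt.le⟩)
    have hs0 : 0 < s := by
      rcases hs.1.eq_or_lt with h | h
      · rw [← h] at hsl; simp [lamf] at hsl; linarith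
      · exact h
    simp at hx
    have hf1 : f 1 ≠ 0 := fun h => hfx (gen_zero N c f lam hc hf h x hx.1 hx.2)
    have hf' : ∀ x ∈ Finset.Icc 1 N, gen N c (fun y => f y / f 1) x = -lam * (f x / f 1) := by
      intro y hy
      rw [← mul_div_assoc, ← hf y hy, gen, gen]
      split_ifs <;> field_simp <;> ring
    have hSh := gen_Sh N c _ lam hc hf' (div_self hf1)
    have hend := gen_flux_end N (by omega) c _ lam hf'
    have hp := pos s hs0 hs.2 _ (hsl ▸ hSh)
    rcases mul_eq_zero.1 hend with h | h <;> linarith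
  have hmono : lamf N (Real.pi - δ) ≤ lamf N (Real.pi + δ) := by
    unfold lamf
    have : Real.cos ((Real.pi + δ) / N) ≤ Real.cos ((Real.pi - δ) / N) := by
      apply Real.cos_le_cos_of_nonneg_of_le_pi
      · apply div_nonneg <;> linarith
      · have : (Real.pi + δ) / N ≤ 1 := by rw [div_le_one (by linarith)]; linarith
        linarith
      · gcongr; linarith
    linarith
  obtain ⟨lam, hlam, hroot⟩ : ∃ lam ∈ Set.Icc (lamf N (Real.pi - δ)) (lamf N (Real.pi + δ)),
      ∑ z ∈ Finset.Ico 1 (N + 1), (shoot (fun x => 1 / c x) lam (z - 1)).1 = 0 := by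
    have hcont : ContinuousOn (fun lam => ∑ z ∈ Finset.Ico 1 (N + 1),
        (shoot (fun x => 1 / c x) lam (z - 1)).1)
        (Set.Icc (lamf N (Real.pi - δ)) (lamf N (Real.pi + δ))) :=
      (continuous_finsetSum _ (fun z _ => (shoot_cont _ _).1)).continuousOn
    exact intermediate_value_Icc' hmono hcont
      ⟨(neg _ (shoot_Sh N _ _)).le, (pos _ (by linarith) le_rfl _ (shoot_Sh N _ _)).le⟩
  have hl0 := (lamf_bound N hN (Real.pi - δ) (by linarith) (by linarith)).1
  have hmem : lam ∈ {lam : ℝ | 0 < lam ∧ IsEigenvalue N c lam} := by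
    refine ⟨by linarith [hlam.1], _, ⟨1, by simp; omega, ?_⟩,
      Sh_gen N c _ lam hc (shoot_Sh N _ lam) hroot⟩
    simp [shoot]
  exact ⟨le_csInf ⟨lam, hmem⟩ hlow, (csInf_le ⟨_, hlow⟩ hmem).trans hlam.2⟩

lemma lamf_diff (N : ℕ) (hN : 5 ≤ N) (δ lam : ℝ) (h0 : 0 < δ) (h1 : δ < 1)
    (hl : lamf N (Real.pi - δ) ≤ lam) (hu : lam ≤ lamf N (Real.pi + δ)) :
    |lam - lamf N Real.pi| * N ^ 2 ≤ 16 * δ := by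
  have hpi := Real.pi_gt_three
  have hpi4 := Real.pi_le_four
  have hNr : (5:ℝ) ≤ N := by exact_mod_cast hN
  have hm : ∀ a b : ℝ, 0 ≤ a → a ≤ b → b ≤ 5 → lamf N a ≤ lamf N b := by
    intro a b ha hab hb
    unfold lamf
    have : Real.cos (b / N) ≤ Real.cos (a / N) := by
      apply Real.cos_le_cos_of_nonneg_of_le_pi
      · positivity
      · have : b / N ≤ 1 := by rw [div_le_one (by linarith)]; linarith
        linarith
      · gcongr
    linarith
  have m1 := hm (Real.pi - δ) Real.pi (by linarith) (by linarith) (by linarith)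
  have m2 := hm Real.pi (Real.pi + δ) (by linarith) (by linarith) (by linarith)
  have hd : lamf N (Real.pi + δ) - lamf N (Real.pi - δ)
      = 4 * (Real.sin (Real.pi / N) * Real.sin (δ / N)) := by
    unfold lamf
    have e : Real.cos ((Real.pi + δ) / N) - Real.cos ((Real.pi - δ) / N)
        = -2 * Real.sin (Real.pi / N) * Real.sin (δ / N) := by
      rw [Real.cos_sub_cos]; ring_nf
    linarith
  have hle : |lam - lamf N Real.pi| ≤ 4 * (Real.pi / N * (δ / N)) := by
    have b1 : Real.sin (Real.pi / N) * Real.sin (δ / N) ≤ Real.pi / N * (δ / N) := by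
      apply mul_le_mul (Real.sin_le (by positivity)) (Real.sin_le (by positivity)) _ (by positivity)
      apply Real.sin_nonneg_of_nonneg_of_le_pi (by positivity)
      have : δ / N ≤ 1 := by rw [div_le_one (by linarith)]; linarith
      linarith
    rw [abs_le]; constructor <;> linarith
  calc _ ≤ 4 * (Real.pi / N * (δ / N)) * N^2 := by gcongr
    _ = 4 * Real.pi * δ := by field_simp
    _ ≤ 16 * δ := by nlinarith

lemma final_bound (N : ℕ) (hN : 5 ≤ N) (c g : ℕ → ℝ) (hc : ∀ x, 1 ≤ x → x ≤ N - 1 → 0 < c x)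
    (hg : ∀ x ∈ Finset.Icc 1 N, gen N c g x = -(spectralGap N c) * g x) (hg1 : g 1 = 1)
    (δ ε : ℝ) (h0 : 0 < δ) (h1 : δ < 1) (hε0 : 0 ≤ ε) (hε : ε ≤ 1)
    (hr : ∀ n m : ℕ, 1 ≤ n → n < m → m ≤ N →
      |rsum (fun x => 1 / c x) n m - ((m : ℝ) - (n : ℝ))| ≤ ε * N)
    (hεδ : 50 * ε * Real.exp 50 < Real.sin δ / 5) (y : ℕ) (hy1 : 1 ≤ y) (hyN : y < N) :
    |(N : ℝ) * c y * (g (y + 1) - g y) - (N : ℝ) * (hfun N (y + 1) - hfun N y)| ≤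
      25 * (2 * (25 * ε + 16 * δ) * Real.exp 50) + 32 * δ + 100 / N := by
  have hpi := Real.pi_gt_three
  have hpi4 := Real.pi_le_four
  have hNr : (5:ℝ) ≤ N := by exact_mod_cast hN
  have hN0 : (0:ℝ) < N := by linarith
  obtain ⟨hl, hu⟩ := gap_bounds N hN c hc δ ε h0 h1 hε0 hε hr hεδ
  set lam := spectralGap N c with hlam
  have hd := lamf_diff N hN δ lam h0 h1 hl hu
  have hl0 : 0 < lam :=
    (lamf_bound N hN (Real.pi - δ) (by linarith) (by linarith)).1.trans_le hl
  have hla : lam * N ^ 2 ≤ 25 :=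
    le_trans (by gcongr) (lamf_bound N hN (Real.pi + δ) (by linarith) (by linarith)).2
  obtain ⟨hp0, hpa⟩ := lamf_bound N hN Real.pi (by linarith) (by linarith)
  set lam' := lamf N Real.pi with hlam'
  set t := Real.pi / N with ht
  have ht0 : 0 < t := by positivity
  have ht1 : t ≤ 1 := by rw [ht, div_le_one (by linarith)]; linarith
  obtain ⟨q1, q2, q3⟩ := trig_range t ht0 ht1
  have hcmp := compare N (by omega) _ lam lam' g (gh t) 25 (16 * δ) ε
    (gen_Sh N c g lam hc hg hg1) (gh_Sh N t ht0 ht1) hl0.le hla hd hε0 hε hr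
    (fun x _ _ => gh_bound t ht0 ht1 x)
  rw [show (2:ℝ) * 25 = 50 by norm_num] at hcmp
  set b := 2 * (25 * ε + 16 * δ) * Real.exp 50 with hb
  have hb0 : 0 ≤ b := by positivity
  have hS := sum_close N g (gh t) b hb0 y hyN.le hcmp
  have hS' := sum_close N (gh t) (fun _ => 0) 2 (by norm_num) y hyN.le
    (fun x _ _ => by simpa using gh_bound t ht0 ht1 x)
  simp only [Finset.sum_const_zero, sub_zero] at hS'
  have hfl := gen_flux N c g lam hg y hy1 hyN
  have hst := gh_step t ht0 ht1 y
  rw [← gh_sum t ht0 ht1, show 2 - 2 * Real.cos t = lam' from rfl] at hst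
  set S := ∑ z ∈ Finset.Ico 1 (y + 1), g z
  set S' := ∑ z ∈ Finset.Ico 1 (y + 1), gh t z
  have hh : ∀ x, hfun N x = Real.cos (t / 2) * gh t x := by
    intro x
    rw [gh, mul_div_cancel₀ _ (by linarith : Real.cos (t/2) ≠ 0), hfun, ht]
    ring_nf
  have e : (N : ℝ) * c y * (g (y + 1) - g y) - (N : ℝ) * (hfun N (y + 1) - hfun N y)
      = -(N * lam * (S - S')) + (-(N * (lam - lam') * S') + -(N * lam' * S' * (1 - Real.cos (t/2)))) := by
    rw [hh, hh, mul_assoc, hfl, ← mul_sub (Real.cos (t / 2)), hst]; ring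
  rw [e]
  have t1 : |-(N * lam * (S - S'))| ≤ 25 * b := by
    rw [abs_neg, abs_mul, abs_of_pos (by positivity)]
    calc N * lam * |S - S'| ≤ N * lam * (N * b) := by gcongr
      _ = (lam * N^2) * b := by ring
      _ ≤ 25 * b := by gcongr
  have t2 : |-(N * (lam - lam') * S')| ≤ 32 * δ := by
    rw [abs_neg, abs_mul, abs_mul, abs_of_pos hN0]
    calc N * |lam - lam'| * |S'| ≤ N * |lam - lam'| * (N * 2) := by gcongr
      _ = (|lam - lam'| * N^2) * 2 := by ring
      _ ≤ (16 * δ) * 2 := by gcongr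
      _ = _ := by ring
  have t3 : |-(N * lam' * S' * (1 - Real.cos (t/2)))| ≤ 100 / N := by
    have hcos := Real.one_sub_sq_div_two_le_cos (x := t/2)
    have hc1 := Real.cos_le_one (t/2)
    have hct : 1 - Real.cos (t/2) ≤ 2 / N := by
      have : t ≤ 4 / N := by rw [ht]; gcongr
      have h3 : (2:ℝ) / N = 4 / N / 2 := by ring
      rw [h3]
      nlinarith
    rw [abs_neg, abs_mul, abs_mul, abs_of_pos (by positivity : 0 < N * lam'),
      abs_of_nonneg (by linarith : 0 ≤ 1 - Real.cos (t/2))]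
    calc N * lam' * |S'| * (1 - Real.cos (t/2)) ≤ N * lam' * (N * 2) * (2 / N) := by
          gcongr
      _ = (lam' * N^2) * (4 / N) := by ring
      _ ≤ 25 * (4 / N) := by gcongr
      _ = _ := by ring
  have := abs_add_le (-(N * lam * (S - S'))) (-(N * (lam - lam') * S') + -(N * lam' * S' * (1 - Real.cos (t/2))))
  have := abs_add_le (-(N * (lam - lam') * S')) (-(N * lam' * S' * (1 - Real.cos (t/2))))
  linarith

/-- Under condition (LLN), the weighted discrete derivative of the principal
eigenfunction `g_N` (with `g_N(1) = 1`) is uniformly approximated by that of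
`h_N(x) = cos(π(x−1/2)/N)`:
`max_{2 ≤ x ≤ N} |N·c(x−1)·(g_N(x) − g_N(x−1)) − N·(h_N(x) − h_N(x−1))| → 0`. -/
theorem eigenfunction_derivative (c : ℕ → ℕ → ℝ) (g : ℕ → ℕ → ℝ)
    (hc : ∀ N, 2 ≤ N → ∀ x, 1 ≤ x → x ≤ N - 1 → 0 < c N x)
    (hLLN : LLN (fun N x => 1 / c N x))
    (hg : ∀ N, 2 ≤ N → ∀ x ∈ Finset.Icc 1 N,
      gen N (c N) (g N) x = -(spectralGap N (c N)) * g N x)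
    (hg1 : ∀ N, 2 ≤ N → g N 1 = 1) :
    ∀ ε > (0 : ℝ), ∃ N₀ : ℕ, ∀ N ≥ N₀, ∀ x ∈ Finset.Icc 2 N,
      |(N : ℝ) * c N (x - 1) * (g N x - g N (x - 1)) -
        (N : ℝ) * (hfun N x - hfun N (x - 1))| < ε := by
  intro ε hε
  have hE : 0 < Real.exp 50 := Real.exp_pos 50
  obtain ⟨δ, hδ⟩ : ∃ δ, δ = min (1/2) (ε / (4 * (800 * Real.exp 50 + 32))) := ⟨_, rfl⟩
  have hδ0 : 0 < δ := by rw [hδ]; positivity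
  have hδ1 : δ ≤ 1/2 := by rw [hδ]; exact min_le_left _ _
  have hδ2 : δ * (4 * (800 * Real.exp 50 + 32)) ≤ ε := by
    rw [← le_div_iff₀ (by positivity), hδ]; exact min_le_right _ _
  have hsd : 0 < Real.sin δ :=
    Real.sin_pos_of_pos_of_lt_pi hδ0 (by linarith [Real.pi_gt_three])
  obtain ⟨ε₁, hε₁⟩ : ∃ ε₁, ε₁ = min 1 (min (Real.sin δ / (300 * Real.exp 50))
    (ε / (5000 * Real.exp 50))) := ⟨_, rfl⟩
  have he0 : 0 < ε₁ := by rw [hε₁]; positivity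
  have he1 : ε₁ ≤ 1 := by rw [hε₁]; exact min_le_left _ _
  have he2 : ε₁ * (300 * Real.exp 50) ≤ Real.sin δ := by
    rw [← le_div_iff₀ (by positivity), hε₁]
    exact (min_le_right _ _).trans (min_le_left _ _)
  have he3 : ε₁ * (5000 * Real.exp 50) ≤ ε := by
    rw [← le_div_iff₀ (by positivity), hε₁]
    exact (min_le_right _ _).trans (min_le_right _ _)
  obtain ⟨N₁, hN₁⟩ := hLLN ε₁ he0
  obtain ⟨N₂, hN₂⟩ := exists_nat_gt (400 / ε)
  refine ⟨max 5 (max N₁ N₂), fun N hN x hx => ?_⟩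
  have hN5 : 5 ≤ N := le_trans (le_max_left _ _) hN
  have hNN1 : N₁ ≤ N := le_trans (le_trans (le_max_left _ _) (le_max_right _ _)) hN
  have hNN2 : N₂ ≤ N := le_trans (le_trans (le_max_right _ _) (le_max_right _ _)) hN
  simp only [Finset.mem_Icc] at hx
  obtain ⟨y, rfl⟩ : ∃ y, x = y + 1 := ⟨x - 1, by omega⟩
  simp only [Nat.add_sub_cancel]
  have hfin := final_bound N hN5 (c N) (g N) (hc N (by omega)) (hg N (by omega))
    (hg1 N (by omega)) δ ε₁ hδ0 (by linarith) he0.le he1 (hN₁ N hNN1) (by linarith) y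
    (by omega) (by omega)
  have hNr : (0:ℝ) < N := by exact_mod_cast (by omega : 0 < N)
  have h400 : 100 / (N:ℝ) < ε / 4 := by
    have h5 : (N₂:ℝ) ≤ N := by exact_mod_cast hNN2
    have h6 : 400 / ε < N := by linarith
    rw [div_lt_iff₀ hε] at h6
    rw [div_lt_iff₀ hNr]
    linarith
  linarith
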